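/- For every c > 0, there exists exactly one triple (θ, w, λ) ∈ (ℝ^q)³ satisfying the stationarity system B θ + Mᵀ λ = 0, c B w + B λ = 0, and M θ + B w + b = 0; i.e., the saddle point of the regularized Lagrangian is unique. -/

import Mathlib

open Matrix

theorem mulVec_injective_of_rank_eq {n q : ℕ} {Φ : Matrix (Fin n) (Fin q) ℝ}
    (hΦ : Φ.rank = q) : Function.Injective Φ.mulVec := by
  rw [Matrix.mulVec_injective_iff, linearIndependent_iff_card_eq_finrank_span,
    Set.finrank, ← Matrix.rank_eq_finrank_span_cols, hΦ, Fintype.card_fin]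

/-- The linear part of the stationarity system of the Lagrangian
`(c/2) wᵀ B w + (1/2) θᵀ B θ + λᵀ (M θ + B w + b)`. -/
noncomputable def stationarityMap {ι : Type*} [Fintype ι] (B M : Matrix ι ι ℝ) (c : ℝ) :
    ((ι → ℝ) × (ι → ℝ) × (ι → ℝ)) →ₗ[ℝ] ((ι → ℝ) × (ι → ℝ) × (ι → ℝ)) where
  toFun x := (B *ᵥ x.1 + Mᵀ *ᵥ x.2.2, c • B *ᵥ x.2.1 + B *ᵥ x.2.2, M *ᵥ x.1 + B *ᵥ x.2.1)
  map_add' x y := by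
    ext i <;> simp [Matrix.mulVec_add] <;> ring
  map_smul' r x := by
    ext i <;> simp [Matrix.mulVec_smul] <;> ring

theorem stationarityMap_injective {ι : Type*} [Fintype ι] {B : Matrix ι ι ℝ} (hB : B.PosDef)
    (M : Matrix ι ι ℝ) {c : ℝ} (hc : 0 < c) : Function.Injective (stationarityMap B M c) := by
  classical
  have pos : ∀ v : ι → ℝ, v ≠ 0 → 0 < v ⬝ᵥ B *ᵥ v := fun v hv => by
    simpa using hB.dotProduct_mulVec_pos hv
  have nonneg : ∀ v : ι → ℝ, 0 ≤ v ⬝ᵥ B *ᵥ v := fun v => by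
    simpa using hB.posSemidef.dotProduct_mulVec_nonneg v
  have eq_zero : ∀ v : ι → ℝ, v ⬝ᵥ B *ᵥ v = 0 → v = 0 := fun v h => by
    by_contra hv
    exact (pos v hv).ne' h
  rw [injective_iff_map_eq_zero]
  rintro ⟨θ, w, l⟩ h
  simp only [stationarityMap, LinearMap.coe_mk, AddHom.coe_mk, Prod.mk_eq_zero] at h
  obtain ⟨hθ, hw, hl⟩ := h
  have hsum : c • w + l = 0 := eq_zero _ (by
    rw [Matrix.mulVec_add, Matrix.mulVec_smul, hw, dotProduct_zero])
  obtain rfl : l = -(c • w) := (neg_eq_of_add_eq_zero_right hsum).symm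
  have hdotθ := congrArg (θ ⬝ᵥ ·) hθ
  have hdotw := congrArg (w ⬝ᵥ ·) hl
  have hM : θ ⬝ᵥ Mᵀ *ᵥ w = w ⬝ᵥ M *ᵥ θ := by
    rw [Matrix.mulVec_transpose, dotProduct_comm, Matrix.dotProduct_mulVec]
  simp only [dotProduct_add, Matrix.mulVec_neg, Matrix.mulVec_smul, dotProduct_neg,
    dotProduct_smul, smul_eq_mul, dotProduct_zero, hM] at hdotθ hdotw
  have key : θ ⬝ᵥ B *ᵥ θ + c * (w ⬝ᵥ B *ᵥ w) = 0 := by linear_combination hdotθ + c * hdotw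
  have hcw := mul_nonneg hc.le (nonneg w)
  have hθ0 : θ = 0 := eq_zero _ (by linarith [nonneg θ])
  have hw0 : w = 0 := eq_zero _ (by
    have : c * (w ⬝ᵥ B *ᵥ w) = 0 := by linarith [nonneg θ]
    exact (mul_eq_zero.mp this).resolve_left hc.ne')
  simp [hθ0, hw0]

/-- for every `c > 0` the stationarity system of the regularized
Lagrangian has exactly one solution `(θ, w, λ)`. -/
theorem stmt_7 (n q : ℕ) (hn : 0 < n) (hq : 0 < q)
    (Φ : Matrix (Fin n) (Fin q) ℝ) (d : Fin n → ℝ) (hd : ∀ i, 0 < d i)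
    (P : Matrix (Fin n) (Fin n) ℝ) (R : Fin n → ℝ)
    (γ : ℝ) (hγ : 0 < γ ∧ γ < 1)
    (hΦ : Φ.rank = q)
    (M B : Matrix (Fin q) (Fin q) ℝ) (b : Fin q → ℝ)
    (hM : M = Φᵀ * Matrix.diagonal d * (γ • P - 1) * Φ)
    (hB : B = Φᵀ * Matrix.diagonal d * Φ)
    (hb : b = (Φᵀ * Matrix.diagonal d).mulVec R) :
    ∀ c : ℝ, 0 < c →
      ∃! x : (Fin q → ℝ) × (Fin q → ℝ) × (Fin q → ℝ),
        B.mulVec x.1 + Mᵀ.mulVec x.2.2 = 0 ∧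
        c • B.mulVec x.2.1 + B.mulVec x.2.2 = 0 ∧
        M.mulVec x.1 + B.mulVec x.2.1 + b = 0 := by
  intro c hc
  have hBpos : B.PosDef := by
    rw [hB, ← Matrix.conjTranspose_eq_transpose_of_trivial]
    exact (Matrix.PosDef.diagonal hd).conjTranspose_mul_mul_same (mulVec_injective_of_rank_eq hΦ)
  have hinj := stationarityMap_injective hBpos M hc
  have hbij : Function.Bijective (stationarityMap B M c) :=
    ⟨hinj, LinearMap.injective_iff_surjective.mp hinj⟩
  simpa [stationarityMap, Prod.ext_iff, eq_neg_iff_add_eq_zero] using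
    hbij.existsUnique (0, 0, -b)
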